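/- Let I be a lexsegment ideal of S = K[x_1,…,x_n] generated by monomials of degree d with μ(I) ≤ ξ_{n−1}, where ξ_k = Σ_{j=1}^k C(2j−1, j). Then hdepth_1(I) ≥ 2. -/

import Mathlib

noncomputable section

open MvPolynomial

/-- The total degree of an exponent vector. -/
def edeg {n : ℕ} (a : Fin n →₀ ℕ) : ℕ := ∑ i, a i

/-- An exponent vector is squarefree if every exponent is at most 1. -/
def IsSqfree {n : ℕ} (a : Fin n →₀ ℕ) : Prop := ∀ i, a i ≤ 1

/-- The set of exponent vectors of monomials belonging to the ideal `I`. -/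
def expSet {K : Type} [Field K] {n : ℕ} (I : Ideal (MvPolynomial (Fin n) K)) :
    Set (Fin n →₀ ℕ) := {a | (monomial a (1 : K)) ∈ I}

/-- `I` is generated by monomials `x^a` with `a` satisfying the predicate `P`. -/
def GenBy {K : Type} [Field K] {n : ℕ} (I : Ideal (MvPolynomial (Fin n) K))
    (P : (Fin n →₀ ℕ) → Prop) : Prop :=
  ∃ G : Set (Fin n →₀ ℕ), (∀ a ∈ G, P a) ∧
    I = Ideal.span ((fun a => (monomial a (1 : K))) '' G)

/-- `I` is a monomial ideal. -/
def IsMonomialIdeal {K : Type} [Field K] {n : ℕ} (I : Ideal (MvPolynomial (Fin n) K)) : Prop :=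
  GenBy I fun _ => True

/-- `I` is a squarefree monomial ideal. -/
def IsSqfreeMonomialIdeal {K : Type} [Field K] {n : ℕ}
    (I : Ideal (MvPolynomial (Fin n) K)) : Prop := GenBy I IsSqfree

/-- `x^a >_lex x^b` in the lexicographic order with `x_1 > x_2 > ⋯ > x_n`. -/
def lexGT {n : ℕ} (a b : Fin n →₀ ℕ) : Prop :=
  ∃ i : Fin n, (∀ j : Fin n, j < i → a j = b j) ∧ b i < a i

/-- `I` is a lexsegment ideal. -/
def IsLexsegment {K : Type} [Field K] {n : ℕ} (I : Ideal (MvPolynomial (Fin n) K)) : Prop :=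
  IsMonomialIdeal I ∧ ∀ a b : Fin n →₀ ℕ, (monomial a (1 : K)) ∈ I → edeg b = edeg a →
    lexGT b a → (monomial b (1 : K)) ∈ I

/-- `I` is a squarefree lexsegment ideal. -/
def IsSqfreeLexsegment {K : Type} [Field K] {n : ℕ}
    (I : Ideal (MvPolynomial (Fin n) K)) : Prop :=
  IsSqfreeMonomialIdeal I ∧ ∀ a b : Fin n →₀ ℕ, IsSqfree a → IsSqfree b →
    (monomial a (1 : K)) ∈ I → edeg b = edeg a → lexGT b a → (monomial b (1 : K)) ∈ I

/-- The minimal number of generators of an ideal. -/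
def mu {K : Type} [Field K] {n : ℕ} (I : Ideal (MvPolynomial (Fin n) K)) : ℕ :=
  sInf {m | ∃ G : Finset (MvPolynomial (Fin n) K), G.card = m ∧ I = Ideal.span (G : Set _)}

/-- `ξ_k = ∑_{j=1}^k C(2j-1, j)`. -/
def xi (k : ℕ) : ℕ := ∑ j ∈ Finset.Icc 1 k, (2 * j - 1).choose j

/-- The Hilbert function of `I`: the `K`-dimension of the degree-`j` component of `I`. -/
def hilb {K : Type} [Field K] {n : ℕ} (I : Ideal (MvPolynomial (Fin n) K)) (j : ℕ) : ℕ :=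
  Module.finrank K ↥((Submodule.restrictScalars K I) ⊓ homogeneousSubmodule (Fin n) K j)

/-- The Hilbert function of `I` extended to all integer degrees. -/
def hilbZ {K : Type} [Field K] {n : ℕ} (I : Ideal (MvPolynomial (Fin n) K)) (j : ℤ) : ℕ :=
  if 0 ≤ j then hilb I j.toNat else 0

/-- The Hilbert function of a standard graded polynomial ring in `d` variables,
at degree `t ∈ ℤ`. -/
def polyHilb (d : ℕ) (t : ℤ) : ℕ :=
  if t < 0 then 0 else if d = 0 then (if t = 0 then 1 else 0) else (t.toNat + (d - 1)).choose (d - 1)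

/-- A (standard graded) Hilbert decomposition of `I` all of whose retracts are polynomial
rings in at least `k` variables: `I ≅ ⊕ᵢ Sᵢ(-sᵢ)` as graded `K`-vector spaces, where `Sᵢ`
is a graded algebra retract of `S`, i.e. a polynomial ring in `dd i ≥ k` variables. -/
def HilbertDecomp1 {K : Type} [Field K] {n : ℕ} (I : Ideal (MvPolynomial (Fin n) K))
    (k : ℕ) : Prop :=
  ∃ (ι : Type) (_ : Fintype ι) (dd : ι → ℕ) (s : ι → ℤ),
    (∀ i, k ≤ dd i) ∧ ∀ j : ℤ, hilbZ I j = ∑ i, polyHilb (dd i) (j - s i)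

/-- The Hilbert depth of `I` in the standard graded sense. -/
def hdepth1 {K : Type} [Field K] {n : ℕ} (I : Ideal (MvPolynomial (Fin n) K)) : ℕ∞ :=
  sSup {k : ℕ∞ | ∃ m : ℕ, HilbertDecomp1 I m ∧ k = m}

/-- The set of exponent vectors `u + ℕ^Z`, corresponding to the Stanley space `x^u K[Z]`. -/
def cone {n : ℕ} (u : Fin n →₀ ℕ) (Z : Finset (Fin n)) : Set (Fin n →₀ ℕ) :=
  {a | (∀ j, u j ≤ a j) ∧ ∀ j ∉ Z, a j = u j}

/-- A Stanley decomposition, with all Stanley spaces of dimension at least `k`, of the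
`ℤⁿ`-graded module whose monomial basis has exponent set `A`. -/
def StanleyPartN {n : ℕ} (A : Set (Fin n →₀ ℕ)) (k : ℕ) : Prop :=
  ∃ (ι : Type) (_ : Fintype ι) (u : ι → (Fin n →₀ ℕ)) (Z : ι → Finset (Fin n)),
    (∀ i, k ≤ (Z i).card) ∧ (∀ i, cone (u i) (Z i) ⊆ A) ∧
    (∀ a ∈ A, ∃! i, a ∈ cone (u i) (Z i))

/-- The multigraded Stanley depth of the `ℤⁿ`-graded module whose monomial basis has
exponent set `A`. -/
def sdepthN {n : ℕ} (A : Set (Fin n →₀ ℕ)) : ℕ∞ :=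
  sSup {k : ℕ∞ | ∃ m : ℕ, StanleyPartN A m ∧ k = m}

/-- A multigraded Hilbert decomposition of the monomial ideal `I`, with all retracts
polynomial rings in at least `k` variables: the multigraded Hilbert function of `I`
(which takes values 0 and 1) equals the sum of the multigraded Hilbert functions of
the shifted retracts `x^{u i} K[Z i]`. -/
def HilbertDecompN {K : Type} [Field K] {n : ℕ} (I : Ideal (MvPolynomial (Fin n) K))
    (k : ℕ) : Prop :=
  ∃ (ι : Type) (_ : Fintype ι) (u : ι → (Fin n →₀ ℕ)) (Z : ι → Finset (Fin n)),
    (∀ i, k ≤ (Z i).card) ∧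
    (∀ a : Fin n →₀ ℕ, (a ∈ expSet I ↔ ∃ i, a ∈ cone (u i) (Z i)) ∧
      (∀ i i', a ∈ cone (u i) (Z i) → a ∈ cone (u i') (Z i') → i = i'))

/-- The multigraded Hilbert depth of a monomial ideal `I`. -/
def hdepthN {K : Type} [Field K] {n : ℕ} (I : Ideal (MvPolynomial (Fin n) K)) : ℕ∞ :=
  sSup {k : ℕ∞ | ∃ m : ℕ, HilbertDecompN I m ∧ k = m}

/-- The graded maximal ideal `(x_1, …, x_n)`. -/
def maxIdeal (K : Type) [Field K] (n : ℕ) : Ideal (MvPolynomial (Fin n) K) :=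
  Ideal.span (Set.range X)

/-- The depth of a module `M` over `S = K[x_1,…,x_n]` with respect to the graded maximal
ideal: the supremum of lengths of `M`-regular sequences in `(x_1,…,x_n)`. -/
def mdepth (K : Type) [Field K] (n : ℕ) (M : Type)
    [AddCommGroup M] [Module (MvPolynomial (Fin n) K) M] : ℕ∞ :=
  sSup {k : ℕ∞ | ∃ rs : List (MvPolynomial (Fin n) K),
    (∀ r ∈ rs, r ∈ maxIdeal K n) ∧ RingTheory.Sequence.IsRegular M rs ∧ k = rs.length}

/-- The quotient module `I/J` for ideals `J ≤ I`. -/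
def quotMod {K : Type} [Field K] {n : ℕ} (I J : Ideal (MvPolynomial (Fin n) K)) : Type :=
  ↥I ⧸ (Submodule.comap (Submodule.subtype I) J)

instance {K : Type} [Field K] {n : ℕ} (I J : Ideal (MvPolynomial (Fin n) K)) :
    AddCommGroup (quotMod I J) := by unfold quotMod; infer_instance

instance {K : Type} [Field K] {n : ℕ} (I J : Ideal (MvPolynomial (Fin n) K)) :
    Module (MvPolynomial (Fin n) K) (quotMod I J) := by unfold quotMod; infer_instance

/-- `ρ_j(I\J)`: the number of squarefree monomials of degree `j` in `I ∖ J`. -/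
def rho {K : Type} [Field K] {n : ℕ} (I J : Ideal (MvPolynomial (Fin n) K)) (j : ℕ) : ℕ :=
  Set.ncard {a : Fin n →₀ ℕ | IsSqfree a ∧ edeg a = j ∧ a ∈ expSet I ∧ a ∉ expSet J}

/-- `ρ_j(I)`: the number of squarefree monomials of degree `j` in `I`. -/
def rhoI {K : Type} [Field K] {n : ℕ} (I : Ideal (MvPolynomial (Fin n) K)) (j : ℕ) : ℕ :=
  Set.ncard {a : Fin n →₀ ℕ | IsSqfree a ∧ edeg a = j ∧ a ∈ expSet I}

/-- `I` is a stable monomial ideal. Here `j` plays the role of `m(u)`, the largest index of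
a variable dividing `u = x^a`. -/
def IsStable {K : Type} [Field K] {n : ℕ} (I : Ideal (MvPolynomial (Fin n) K)) : Prop :=
  IsMonomialIdeal I ∧ ∀ a : Fin n →₀ ℕ, (monomial a (1 : K)) ∈ I →
    ∀ j : Fin n, a j ≠ 0 → (∀ l, j < l → a l = 0) → ∀ i, i < j →
      (monomial (a + Finsupp.single i 1 - Finsupp.single j 1) (1 : K)) ∈ I

/-- `I` is a squarefree stable monomial ideal. -/
def IsSqfreeStable {K : Type} [Field K] {n : ℕ} (I : Ideal (MvPolynomial (Fin n) K)) : Prop :=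
  IsSqfreeMonomialIdeal I ∧ ∀ a : Fin n →₀ ℕ, IsSqfree a → (monomial a (1 : K)) ∈ I →
    ∀ j : Fin n, a j ≠ 0 → (∀ l, j < l → a l = 0) → ∀ i, i < j → a i = 0 →
      (monomial (a + Finsupp.single i 1 - Finsupp.single j 1) (1 : K)) ∈ I

/-- `I` is a squarefree strongly stable monomial ideal. -/
def IsSqfreeStronglyStable {K : Type} [Field K] {n : ℕ}
    (I : Ideal (MvPolynomial (Fin n) K)) : Prop :=
  IsSqfreeMonomialIdeal I ∧ ∀ a : Fin n →₀ ℕ, IsSqfree a → (monomial a (1 : K)) ∈ I →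
    ∀ i : Fin n, a i ≠ 0 → ∀ j, j < i → a j = 0 →
      (monomial (a + Finsupp.single j 1 - Finsupp.single i 1) (1 : K)) ∈ I

/-- The exponent vectors of the minimal monomial generators of a monomial ideal:
the monomials of `I` minimal with respect to divisibility. -/
def minGens {K : Type} [Field K] {n : ℕ} (I : Ideal (MvPolynomial (Fin n) K)) :
    Set (Fin n →₀ ℕ) := {a | a ∈ expSet I ∧ ∀ b ∈ expSet I, b ≤ a → b = a}

/-- `m(u)`: the largest index (1-based) of a variable dividing `x^a`; `0` if `a = 0`. -/
def mvar {n : ℕ} (a : Fin n →₀ ℕ) : ℕ := a.support.sup (fun i => (i : ℕ) + 1)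

/-- `m(I) = max { m(u) : u ∈ G(I) }`. -/
def mIdeal {K : Type} [Field K] {n : ℕ} (I : Ideal (MvPolynomial (Fin n) K)) : ℕ :=
  sSup {m | ∃ a ∈ minGens I, m = mvar a}

open MvPolynomial

/-- The `K`-subspace `Aᵢ·xᵢ` of `S`, where `Aᵢ` is the subalgebra generated by `B`. -/
def stSpace {K : Type} [Field K] {n : ℕ} (B : Finset (MvPolynomial (Fin n) K))
    (x : MvPolynomial (Fin n) K) : Submodule K (MvPolynomial (Fin n) K) :=
  (Subalgebra.toSubmodule (Algebra.adjoin K (B : Set (MvPolynomial (Fin n) K)))).map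
    (LinearMap.mulLeft K x)

/-- A standard graded Stanley decomposition of the ideal `I` with all Stanley spaces of
depth at least `k`: a finite family of graded algebra retracts `Sᵢ = K[Bᵢ]` (generated by
`k ≤ |Bᵢ|` linearly independent linear forms) and homogeneous elements `xᵢ ∈ I` with
`Sᵢ ∩ ann(xᵢ) = 0`, such that `I = ⊕ᵢ Sᵢ xᵢ` as graded `K`-vector spaces. -/
def StanleyDecomp1 {K : Type} [Field K] {n : ℕ} (I : Ideal (MvPolynomial (Fin n) K))
    (k : ℕ) : Prop :=
  ∃ (ι : Type) (_ : Fintype ι) (B : ι → Finset (MvPolynomial (Fin n) K))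
    (x : ι → MvPolynomial (Fin n) K) (d : ι → ℕ),
      (∀ i, ∀ b ∈ B i, b ∈ homogeneousSubmodule (Fin n) K 1) ∧
      (∀ i, LinearIndependent K (fun b : (B i : Set (MvPolynomial (Fin n) K)) =>
        (b : MvPolynomial (Fin n) K))) ∧
      (∀ i, k ≤ (B i).card) ∧
      (∀ i, x i ∈ I) ∧
      (∀ i, x i ∈ homogeneousSubmodule (Fin n) K (d i)) ∧
      (∀ i, ∀ a ∈ Algebra.adjoin K ((B i : Set (MvPolynomial (Fin n) K))),
        a * x i = 0 → a = 0) ∧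
      (iSup (fun i => stSpace (B i) (x i)) = Submodule.restrictScalars K I) ∧
      (iSupIndep fun i => stSpace (B i) (x i))

/-- The standard graded Stanley depth of `I`. -/
def sdepth1 {K : Type} [Field K] {n : ℕ} (I : Ideal (MvPolynomial (Fin n) K)) : ℕ∞ :=
  sSup {k : ℕ∞ | ∃ m : ℕ, StanleyDecomp1 I m ∧ k = m}

/-- The subspace `S₁ · V` of `S`. -/
def mulS1 {K : Type} [Field K] {n : ℕ} (V : Submodule K (MvPolynomial (Fin n) K)) :
    Submodule K (MvPolynomial (Fin n) K) :=
  Submodule.span K {p | ∃ l ∈ homogeneousSubmodule (Fin n) K 1, ∃ v ∈ V, p = l * v}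

/-- A lexsegment set of monomials of degree `d`. -/
def IsLexSet {n : ℕ} (d : ℕ) (L : Set (Fin n →₀ ℕ)) : Prop :=
  (∀ a ∈ L, edeg a = d) ∧ ∀ a ∈ L, ∀ b : Fin n →₀ ℕ, edeg b = d → lexGT b a → b ∈ L

/-- `V ⊆ S_d` is a Gotzmann space: `dim_K (S₁·V) = dim_K (S₁·lex(V))`, where `lex(V)` is
spanned by the lexsegment set of monomials of degree `d` of cardinality `dim_K V`. -/
def IsGotzmannSpace {K : Type} [Field K] {n : ℕ} (d : ℕ)
    (V : Submodule K (MvPolynomial (Fin n) K)) : Prop :=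
  ∃ L : Finset (Fin n →₀ ℕ), IsLexSet (n := n) d (L : Set (Fin n →₀ ℕ)) ∧ L.card = Module.finrank K ↥V ∧
    Module.finrank K ↥(mulS1 V) =
      Module.finrank K ↥(mulS1 (Submodule.span K
        ((fun a => (monomial a (1 : K))) '' (L : Set (Fin n →₀ ℕ)))))

/-- `I` is a homogeneous ideal in the standard grading. -/
def IsHomogeneousIdeal {K : Type} [Field K] {n : ℕ}
    (I : Ideal (MvPolynomial (Fin n) K)) : Prop :=
  ∀ p ∈ I, ∀ k : ℕ, homogeneousComponent k p ∈ I

/-- `I` is a Gotzmann ideal: each homogeneous component `I_k` is a Gotzmann space. -/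
def IsGotzmannIdeal {K : Type} [Field K] {n : ℕ}
    (I : Ideal (MvPolynomial (Fin n) K)) : Prop :=
  IsHomogeneousIdeal I ∧ ∀ k : ℕ,
    IsGotzmannSpace k ((Submodule.restrictScalars K I) ⊓ homogeneousSubmodule (Fin n) K k)

/-- `I` is generated by homogeneous elements of degree `d`. -/
def GenInDegHomog {K : Type} [Field K] {n : ℕ} (I : Ideal (MvPolynomial (Fin n) K))
    (d : ℕ) : Prop :=
  ∃ G : Set (MvPolynomial (Fin n) K), (∀ g ∈ G, g ∈ homogeneousSubmodule (Fin n) K d) ∧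
    I = Ideal.span G

/-! ### Numerical facts about multiset coefficients -/

lemma succ_mul_multichoose_succ (n d : ℕ) :
    (d + 1) * n.multichoose (d + 1) = (n + d) * n.multichoose d := by
  rcases n with _ | n
  · rcases d with _ | d <;> simp
  · rw [Nat.multichoose_eq, Nat.multichoose_eq]
    have h := Nat.add_one_mul_choose_eq (n + d) d
    have e1 : n + 1 + (d + 1) - 1 = n + d + 1 := by omega
    have e2 : n + 1 + d - 1 = n + d := by omega
    rw [e1, e2]
    linarith

lemma two_mul_multichoose_le {n d : ℕ} (h : d + 2 ≤ n) :
    2 * n.multichoose d ≤ n.multichoose (d + 1) := by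
  have h1 := succ_mul_multichoose_succ n d
  have h2 : (d + 1) * (2 * n.multichoose d) ≤ (d + 1) * n.multichoose (d + 1) := by
    rw [h1]
    nlinarith [Nat.zero_le (n.multichoose d)]
  exact Nat.le_of_mul_le_mul_left h2 (Nat.succ_pos d)

lemma multichoose_succ_le_two_mul {n d : ℕ} (h : n ≤ d + 2) :
    n.multichoose (d + 1) ≤ 2 * n.multichoose d := by
  have h1 := succ_mul_multichoose_succ n d
  have h2 : (d + 1) * n.multichoose (d + 1) ≤ (d + 1) * (2 * n.multichoose d) := by
    rw [h1]
    nlinarith [Nat.zero_le (n.multichoose d)]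
  exact Nat.le_of_mul_le_mul_left h2 (Nat.succ_pos d)

lemma multichoose_mono_right {n d e : ℕ} (h : d ≤ e) :
    (n + 1).multichoose d ≤ (n + 1).multichoose e := by
  induction e, h using Nat.le_induction with
  | base => exact le_rfl
  | succ e _ ih => rw [Nat.multichoose_succ_succ]; omega

lemma xi_succ (k : ℕ) : xi (k + 1) = xi k + (2 * k + 1).choose k := by
  unfold xi
  rw [Finset.sum_Icc_succ_top (by omega)]
  have e : 2 * (k + 1) - 1 = 2 * k + 1 := by omega
  rw [e, Nat.choose_symm_half]

lemma xi_lt_centralBinom (k : ℕ) : xi k < k.centralBinom := by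
  induction k with
  | zero => simp [xi]
  | succ k ih =>
    have h := Nat.succ_mul_centralBinom_succ k
    have h1 : (k + 1).centralBinom = 2 * (2 * k + 1).choose k := by
      rw [Nat.centralBinom, show 2 * (k + 1) = (2 * k + 1) + 1 by ring, Nat.choose_succ_succ,
        Nat.choose_symm_half]
      ring
    have h2 : k.centralBinom ≤ (2 * k + 1).choose k := by
      rw [Nat.centralBinom]
      exact Nat.choose_le_choose k (by omega)
    rw [xi_succ]
    omega

/-! ### Hilbert functions of lexsegment ideals -/

/-- The possible Hilbert functions `t ↦ dim I_{d+t}` of a lexsegment ideal generated in degree `d`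
in `n` variables. -/
inductive LexHilb : ℕ → ℕ → (ℕ → ℕ) → Prop
  | zero (n d : ℕ) : LexHilb n d fun _ => 0
  | one (n : ℕ) : LexHilb (n + 1) 0 fun t => (n + 1).multichoose t
  | mul_first {n d : ℕ} {H : ℕ → ℕ} : LexHilb (n + 1) d H → LexHilb (n + 1) (d + 1) H
  | add_first {n d : ℕ} {H : ℕ → ℕ} : LexHilb n (d + 1) H →
      LexHilb (n + 1) (d + 1) fun t => (n + 1).multichoose (d + t) + H t

/-- `H 1 - 2 * H 0` is bounded below by zero or by its value for the full degree component. -/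
lemma LexHilb.lower_bound {n d : ℕ} {H : ℕ → ℕ} (h : LexHilb n d H) :
    2 * H 0 ≤ H 1 ∨ n.multichoose (d + 1) + 2 * H 0 ≤ H 1 + 2 * n.multichoose d := by
  induction h with
  | zero n d => simp
  | one n => right; simp
  | @mul_first n d H _ ih =>
    have r1 := Nat.multichoose_succ_succ n d
    have r2 := Nat.multichoose_succ_succ n (d + 1)
    rcases ih with ih | ih
    · exact Or.inl ih
    · rcases le_or_gt (d + 2) (n + 1) with hd | hd
      · have := two_mul_multichoose_le hd
        omega
      · have := multichoose_succ_le_two_mul (n := n) (d := d + 1) (by omega)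
        omega
  | @add_first n d H _ ih =>
    have r1 := Nat.multichoose_succ_succ n d
    have r2 := Nat.multichoose_succ_succ n (d + 1)
    simp only [add_zero]
    rcases ih with ih | ih
    · rcases le_or_gt (d + 2) (n + 1) with hd | hd
      · have := two_mul_multichoose_le hd
        omega
      · have := multichoose_succ_le_two_mul (n := n) (d := d + 1) (by omega)
        omega
    · omega

lemma LexHilb.two_mul_le {n d : ℕ} {H : ℕ → ℕ} (h : LexHilb n d H) (hx : H 0 ≤ xi (n - 1)) :
    2 * H 0 ≤ H 1 := by
  induction h with
  | zero n d => simp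
  | one n =>
    rcases n with _ | n
    · simp [xi] at hx
    · simp
  | mul_first _ ih => exact ih hx
  | @add_first n d H h ih =>
    simp only [Nat.add_sub_cancel, add_zero] at hx ⊢
    rcases lt_trichotomy (d + 1) n with hd | hd | hd
    · have h1 := (LexHilb.add_first h).lower_bound
      have h2 := two_mul_multichoose_le (n := n + 1) (d := d + 1) (by omega)
      simp only [add_zero] at h1
      omega
    · subst hd
      have h1 := two_mul_multichoose_le (n := d + 1 + 1) (d := d) (by omega)
      have h2 : (d + 1 + 1).multichoose d = (2 * d + 1).choose d := by
        rw [Nat.multichoose_eq]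
        congr 1
        omega
      rw [xi_succ, h2] at hx
      have h3 := ih (by simp only [Nat.add_sub_cancel]; omega)
      omega
    · have h1 := multichoose_mono_right (n := n) (show n ≤ d by omega)
      have h2 : (n + 1).multichoose n = n.centralBinom := by
        rw [Nat.multichoose_eq, Nat.centralBinom]
        congr 1
        omega
      have h3 := xi_lt_centralBinom n
      omega

/-- `H` is a sum of Hilbert functions of polynomial rings in at least one variable; those in one
variable are counted by the constant `a`. -/
def PolySum (H : ℕ → ℕ) : Prop :=
  ∃ (a : ℕ) (T : Multiset ℕ), (∀ r ∈ T, 2 ≤ r) ∧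
    ∀ t, H t = a + (T.map fun r => r.multichoose t).sum

lemma PolySum.zero : PolySum fun _ => 0 := ⟨0, 0, by simp, by simp⟩

lemma PolySum.add {H H' : ℕ → ℕ} (h : PolySum H) (h' : PolySum H') :
    PolySum fun t => H t + H' t := by
  obtain ⟨a, T, hT, hH⟩ := h
  obtain ⟨a', T', hT', hH'⟩ := h'
  refine ⟨a + a', T + T', ?_, fun t => ?_⟩
  · intro r hr
    rcases Multiset.mem_add.1 hr with hr | hr
    exacts [hT r hr, hT' r hr]
  · simp only [hH, hH', Multiset.map_add, Multiset.sum_add]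
    omega

lemma PolySum.multichoose_add (n d : ℕ) : PolySum fun t => (n + 1).multichoose (d + t) := by
  induction n generalizing d with
  | zero => exact ⟨1, 0, by simp, by simp⟩
  | succ n ihn =>
    induction d with
    | zero => exact ⟨0, {n + 1 + 1}, by simp, by simp⟩
    | succ d ihd =>
      have := (ihn (d + 1)).add ihd
      convert this using 2 with t
      rw [show d + 1 + t = d + t + 1 by ring, Nat.multichoose_succ_succ]

lemma LexHilb.polySum {n d : ℕ} {H : ℕ → ℕ} (h : LexHilb n d H) : PolySum H := by
  induction h with
  | zero n d => exact PolySum.zero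
  | one n => simpa using PolySum.multichoose_add n 0
  | mul_first _ ih => exact ih
  | @add_first n d H _ ih => exact (PolySum.multichoose_add n d).add ih

/-! ### Decompositions into polynomial rings in at least two variables -/

lemma polyHilb_of_neg (r : ℕ) {t : ℤ} (ht : t < 0) : polyHilb r t = 0 := by
  simp [polyHilb, ht]

lemma polyHilb_natCast (r t : ℕ) : polyHilb r t = r.multichoose t := by
  unfold polyHilb
  rcases r with _ | r
  · rcases t with _ | t
    · simp
    · have : (t : ℤ) + 1 ≠ 0 := by omega
      simp [this]
  · have h : ¬ ((t : ℤ) < 0) := by omega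
    simp only [h, if_false, Nat.succ_ne_zero, Int.toNat_natCast, Nat.add_sub_cancel]
    rw [Nat.multichoose_eq, show r + 1 + t - 1 = t + r by omega, Nat.choose_symm_add]

lemma polyHilb_succ (r : ℕ) (t : ℤ) :
    polyHilb (r + 1) t = polyHilb r t + polyHilb (r + 1) (t - 1) := by
  rcases lt_or_ge t 0 with ht | ht
  · rw [polyHilb_of_neg _ ht, polyHilb_of_neg _ ht, polyHilb_of_neg _ (by omega)]
  · lift t to ℕ using ht
    rcases t with _ | t
    · rw [polyHilb_of_neg _ (by simp : ((0 : ℕ) : ℤ) - 1 < 0), polyHilb_natCast, polyHilb_natCast]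
      simp
    · have e : ((t + 1 : ℕ) : ℤ) - 1 = (t : ℤ) := by push_cast; ring
      rw [e, polyHilb_natCast, polyHilb_natCast, polyHilb_natCast, Nat.multichoose_succ_succ]

/-- `f` is a finite sum of Hilbert functions of shifted polynomial rings in at least two
variables. -/
def ShiftedPolySum (f : ℤ → ℕ) : Prop :=
  ∃ M : Multiset (ℕ × ℤ), (∀ x ∈ M, 2 ≤ x.1) ∧
    ∀ j, f j = (M.map fun x => polyHilb x.1 (j - x.2)).sum

lemma ShiftedPolySum.zero : ShiftedPolySum fun _ => 0 := ⟨0, by simp, by simp⟩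

lemma ShiftedPolySum.add {f g : ℤ → ℕ} (hf : ShiftedPolySum f) (hg : ShiftedPolySum g) :
    ShiftedPolySum fun j => f j + g j := by
  obtain ⟨M, hM, hf⟩ := hf
  obtain ⟨N, hN, hg⟩ := hg
  refine ⟨M + N, ?_, fun j => ?_⟩
  · intro x hx
    rcases Multiset.mem_add.1 hx with hx | hx
    exacts [hM x hx, hN x hx]
  · simp only [hf, hg, Multiset.map_add, Multiset.sum_add]

lemma ShiftedPolySum.polyHilb_sub {r : ℕ} (hr : 2 ≤ r) (s : ℤ) :
    ShiftedPolySum fun j => polyHilb r (j - s) := ⟨{(r, s)}, by simpa using hr, by simp⟩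

lemma ShiftedPolySum.one_add_polyHilb {r : ℕ} (hr : 2 ≤ r) (s : ℤ) :
    ShiftedPolySum fun j => polyHilb 1 (j - s) + polyHilb r (j - s - 1) := by
  induction r, hr using Nat.le_induction with
  | base =>
    convert ShiftedPolySum.polyHilb_sub le_rfl s using 2 with j
    exact (polyHilb_succ 1 (j - s)).symm
  | succ r hr ih =>
    convert ih.add (ShiftedPolySum.polyHilb_sub (show 2 ≤ r + 1 by omega) (s + 2)) using 2 with j
    rw [polyHilb_succ r (j - s - 1), show j - s - 1 - 1 = j - (s + 2) by ring]
    ring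

lemma ShiftedPolySum.mul_one_add_polyHilb {r c : ℕ} (hr : 2 ≤ r) (hc : c ≤ r - 2) (s : ℤ) :
    ShiftedPolySum fun j => c * polyHilb 1 (j - s) + polyHilb r (j - s) := by
  induction r, hr using Nat.le_induction generalizing c with
  | base =>
    obtain rfl : c = 0 := by omega
    simpa using ShiftedPolySum.polyHilb_sub le_rfl s
  | succ r hr ih =>
    rcases c with _ | c
    · simpa using ShiftedPolySum.polyHilb_sub (show 2 ≤ r + 1 by omega) s
    · convert (ih (c := c) (by omega)).add
        (ShiftedPolySum.one_add_polyHilb (show 2 ≤ r + 1 by omega) s) using 2 with j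
      rw [polyHilb_succ r (j - s)]
      ring

lemma ShiftedPolySum.of_le_sum {a : ℕ} {T : Multiset ℕ} (hT : ∀ r ∈ T, 2 ≤ r)
    (ha : a ≤ (T.map fun r => r - 2).sum) (s : ℤ) :
    ShiftedPolySum fun j =>
      a * polyHilb 1 (j - s) + (T.map fun r => polyHilb r (j - s)).sum := by
  induction T using Multiset.induction_on generalizing a with
  | empty =>
    obtain rfl : a = 0 := by simpa using ha
    simpa using ShiftedPolySum.zero
  | cons r T ih =>
    simp only [Multiset.map_cons, Multiset.sum_cons] at ha ⊢
    have hrT : ∀ q ∈ T, 2 ≤ q := fun q hq => hT q (Multiset.mem_cons_of_mem hq)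
    have h1 := ShiftedPolySum.mul_one_add_polyHilb (c := min a (r - 2))
      (hT r (Multiset.mem_cons_self r T)) (min_le_right _ _) s
    have h2 := ih (a := a - min a (r - 2)) hrT (by omega)
    convert h1.add h2 using 2 with j
    obtain ⟨e, he⟩ : ∃ e, a = min a (r - 2) + e := ⟨a - min a (r - 2), by omega⟩
    generalize min a (r - 2) = c at *
    subst he
    rw [Nat.add_sub_cancel_left]
    ring

lemma PolySum.shiftedPolySum {H : ℕ → ℕ} (h : PolySum H) (hH : 2 * H 0 ≤ H 1) {s : ℤ}
    {f : ℤ → ℕ} (hneg : ∀ j < s, f j = 0) (hpos : ∀ t : ℕ, f (s + t) = H t) :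
    ShiftedPolySum f := by
  obtain ⟨a, T, hT, hsum⟩ := h
  have key : ∀ T : Multiset ℕ, (∀ r ∈ T, 2 ≤ r) →
      (T.map fun r => r - 2).sum + 2 * (T.map fun r => r.multichoose 0).sum =
        (T.map fun r => r.multichoose 1).sum := by
    intro T
    induction T using Multiset.induction_on with
    | empty => simp
    | cons r T ih =>
      intro hT
      have h1 := ih fun q hq => hT q (Multiset.mem_cons_of_mem hq)
      have h2 := hT r (Multiset.mem_cons_self r T)
      simp only [Multiset.map_cons, Multiset.sum_cons, Nat.multichoose_zero_right,
        Nat.multichoose_one_right] at h1 ⊢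
      omega
  have hk := key T hT
  rw [hsum, hsum] at hH
  convert ShiftedPolySum.of_le_sum (a := a) hT (by omega) s using 2 with j
  rcases lt_or_ge j s with hj | hj
  · have hj' : j - s < 0 := by omega
    simp [hneg j hj, polyHilb_of_neg _ hj']
  · obtain ⟨t, rfl⟩ : ∃ t : ℕ, j = s + t := ⟨(j - s).toNat, by omega⟩
    rw [hpos, hsum, add_sub_cancel_left]
    simp only [polyHilb_natCast, Nat.multichoose_one, mul_one]

lemma ShiftedPolySum.hilbertDecomp1 {K : Type} [Field K] {n : ℕ}
    {I : Ideal (MvPolynomial (Fin n) K)} (h : ShiftedPolySum (hilbZ I)) : HilbertDecomp1 I 2 := by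
  obtain ⟨M, hM, hsum⟩ := h
  refine ⟨M.ToType, inferInstance, fun i => i.1.1, fun i => i.1.2,
    fun i => hM _ (Multiset.coe_mem), fun j => ?_⟩
  rw [hsum j]
  conv_lhs => rw [← Multiset.map_univ_coe M, Multiset.map_map]
  rfl

/-! ### Lexsegment sets of exponent vectors -/

lemma ncard_eq_ncard_add_single_add_ncard_cons {n : ℕ} {B : Set (Fin (n + 1) → ℕ)}
    (hB : B.Finite) :
    B.ncard = {a : Fin (n + 1) → ℕ | a + Pi.single 0 1 ∈ B}.ncard +
      {a : Fin n → ℕ | (Fin.cons 0 a : Fin (n + 1) → ℕ) ∈ B}.ncard := by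
  have hf : Function.Injective fun a : Fin (n + 1) → ℕ => a + Pi.single 0 1 :=
    add_left_injective _
  have hg : Function.Injective fun a : Fin n → ℕ => (Fin.cons 0 a : Fin (n + 1) → ℕ) :=
    Fin.cons_right_injective (α := fun _ => ℕ) 0
  refine Eq.trans ?_ (congrArg₂ HAdd.hAdd (Set.ncard_image_of_injective _ hf)
    (Set.ncard_image_of_injective _ hg))
  rw [← Set.ncard_union_eq ?_ ?_ ?_]
  · congr 1
    ext a
    constructor
    · intro ha
      rcases Nat.eq_zero_or_pos (a 0) with h0 | h0
      · right
        have e : (Fin.cons 0 (Fin.tail a) : Fin (n + 1) → ℕ) = a := by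
          rw [← h0, Fin.cons_self_tail]
        exact ⟨Fin.tail a, by simpa [e] using ha, e⟩
      · left
        have e : a - Pi.single 0 1 + Pi.single 0 1 = a := by
          refine tsub_add_cancel_of_le fun i => ?_
          rcases eq_or_ne i 0 with rfl | hi
          · simpa only [Pi.single_eq_same] using Nat.succ_le_of_lt h0
          · simp [hi]
        exact ⟨a - Pi.single 0 1, by simpa [e] using ha, e⟩
    · rintro (⟨b, hb, rfl⟩ | ⟨b, hb, rfl⟩)
      exacts [hb, hb]
  · rw [Set.disjoint_left]
    rintro _ ⟨b, -, rfl⟩ ⟨c, -, hc⟩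
    have := congrFun hc 0
    simp at this
  · exact hB.subset (by rintro _ ⟨b, hb, rfl⟩; exact hb)
  · exact hB.subset (by rintro _ ⟨b, hb, rfl⟩; exact hb)

lemma finite_sum_eq (n d : ℕ) : {a : Fin n → ℕ | ∑ i, a i = d}.Finite := by
  refine (Set.finite_Iic (fun _ : Fin n => d)).subset fun a ha i => ?_
  rw [← show ∑ i, a i = d from ha]
  exact Finset.single_le_sum (fun _ _ => Nat.zero_le _) (Finset.mem_univ i)

lemma sum_add_single_zero {n : ℕ} (a : Fin (n + 1) → ℕ) :
    ∑ i, (a + Pi.single 0 1 : Fin (n + 1) → ℕ) i = ∑ i, a i + 1 := by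
  simp [Finset.sum_add_distrib]

lemma ncard_sum_eq (n d : ℕ) : {a : Fin n → ℕ | ∑ i, a i = d}.ncard = n.multichoose d := by
  induction n generalizing d with
  | zero =>
    rcases d with _ | d
    · simp
    · simp
  | succ n ihn =>
    induction d with
    | zero =>
      have : {a : Fin (n + 1) → ℕ | ∑ i, a i = 0} = {0} := by
        ext a
        simp [funext_iff]
      rw [this, Set.ncard_singleton, Nat.multichoose_zero_right]
    | succ d ihd =>
      rw [ncard_eq_ncard_add_single_add_ncard_cons (finite_sum_eq _ _),
        Nat.multichoose_succ_succ, ← ihn, ← ihd, add_comm]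
      simp only [Set.mem_ofPred_eq, sum_add_single_zero, Fin.sum_cons, zero_add,
        Nat.add_right_cancel_iff]

lemma exists_eq_add_single_zero {n : ℕ} {b : Fin (n + 1) → ℕ} (h0 : b 0 ≠ 0) :
    ∃ c : Fin (n + 1) → ℕ, b = c + Pi.single 0 1 := by
  refine ⟨b - Pi.single 0 1, (tsub_add_cancel_of_le fun i => ?_).symm⟩
  rcases eq_or_ne i 0 with rfl | hi
  · simpa only [Pi.single_eq_same] using Nat.one_le_iff_ne_zero.2 h0
  · simp [hi]

/-- The Hilbert function of a lexsegment set of exponent vectors generated in degree `d`. -/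
lemma lexHilb_ncard {n d : ℕ} (hnd : n = 0 → d ≠ 0) (A : Set (Fin n → ℕ))
    (hgen : ∀ a ∈ A, ∃ b ∈ A, b ≤ a ∧ ∑ i, b i = d)
    (hup : ∀ a ∈ A, ∀ b, a ≤ b → b ∈ A)
    (hlex : ∀ a ∈ A, ∀ b : Fin n → ℕ, ∑ i, b i = ∑ i, a i →
      (∃ i, (∀ j < i, b j = a j) ∧ a i < b i) → b ∈ A) :
    LexHilb n d fun t => {a | a ∈ A ∧ ∑ i, a i = d + t}.ncard := by
  induction n generalizing d with
  | zero =>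
    have : A = ∅ := by
      refine Set.eq_empty_iff_forall_notMem.2 fun a ha => ?_
      obtain ⟨b, -, -, hb⟩ := hgen a ha
      simp at hb
      exact hnd rfl hb.symm
    simpa [this] using LexHilb.zero 0 d
  | succ n ihn =>
    induction d generalizing A with
    | zero =>
      rcases A.eq_empty_or_nonempty with hA | ⟨a, ha⟩
      · simpa [hA] using LexHilb.zero (n + 1) 0
      · obtain ⟨b, hb, -, hb0⟩ := hgen a ha
        have hA : ∀ c, c ∈ A := fun c => hup b hb c fun i =>
          (Finset.sum_eq_zero_iff.1 hb0 i (Finset.mem_univ i)).le.trans (Nat.zero_le _)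
        simpa [hA, ncard_sum_eq] using LexHilb.one n
    | succ d ihd =>
      have split : ∀ t, {a | a ∈ A ∧ ∑ i, a i = d + 1 + t}.ncard =
          {a : Fin (n + 1) → ℕ | a + Pi.single 0 1 ∈ A ∧ ∑ i, a i = d + t}.ncard +
          {a : Fin n → ℕ | (Fin.cons 0 a : Fin (n + 1) → ℕ) ∈ A ∧
            ∑ i, a i = d + 1 + t}.ncard := by
        intro t
        rw [ncard_eq_ncard_add_single_add_ncard_cons
          ((finite_sum_eq (n + 1) (d + 1 + t)).subset fun a ha => ha.2)]
        have e : ∀ s : ℕ, s + 1 = d + 1 + t ↔ s = d + t := fun s => by omega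
        simp only [Set.mem_ofPred_eq, sum_add_single_zero, Fin.sum_cons, zero_add, e]
      simp only [split]
      by_cases h0 : ∃ a ∈ A, a 0 = 0
      · obtain ⟨a, ha, ha0⟩ := h0
        obtain ⟨b, hb, hba, hbd⟩ := hgen a ha
        have hb0 : b 0 = 0 := Nat.eq_zero_of_le_zero ((hba 0).trans_eq ha0)
        obtain ⟨k, hk⟩ : ∃ k, b k ≠ 0 := by
          by_contra! hcon
          simp [hcon] at hbd
        have hk0 : k ≠ 0 := by
          rintro rfl
          exact hk hb0
        have hall : ∀ c : Fin (n + 1) → ℕ, ∀ t, ∑ i, c i = d + t → c + Pi.single 0 1 ∈ A := by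
          intro c t hc
          refine hlex (b + Pi.single k t) (hup b hb _ (by simp)) _ ?_ ⟨0, by simp, ?_⟩
          · rw [sum_add_single_zero, hc]
            simp [Finset.sum_add_distrib, hbd]
            omega
          · simp [hb0, hk0.symm]
        have hfull : ∀ t, {a : Fin (n + 1) → ℕ | a + Pi.single 0 1 ∈ A ∧
            ∑ i, a i = d + t}.ncard = (n + 1).multichoose (d + t) := by
          intro t
          rw [← ncard_sum_eq]
          congr 1
          ext c
          exact ⟨fun h => h.2, fun h => ⟨hall c t h, h⟩⟩
        simp only [hfull]
        refine LexHilb.add_first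
          (ihn (by simp) {a : Fin n → ℕ | (Fin.cons 0 a : Fin (n + 1) → ℕ) ∈ A} ?_ ?_ ?_)
        · intro c hc
          obtain ⟨e, he, hec, hed⟩ := hgen _ hc
          have he0 : e 0 = 0 := by have := hec 0; simpa using this
          have hcons : (Fin.cons 0 (Fin.tail e) : Fin (n + 1) → ℕ) = e := by
            rw [← he0, Fin.cons_self_tail]
          refine ⟨Fin.tail e, by simpa [hcons] using he, fun i => ?_, ?_⟩
          · simpa [Fin.tail] using hec i.succ
          · rw [Fin.sum_univ_succ, he0, zero_add] at hed
            exact hed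
        · intro c hc e hce
          refine hup _ hc _ ?_
          rw [Fin.cons_le_cons]
          exact ⟨le_rfl, hce⟩
        · rintro c hc e hsum ⟨i, hi, hlt⟩
          refine hlex _ hc _ (by simpa [Fin.sum_cons] using hsum) ⟨i.succ, fun j hj => ?_, ?_⟩
          · induction j using Fin.cases with
            | zero => simp
            | succ j => simpa using hi j (Fin.succ_lt_succ_iff.1 hj)
          · simpa using hlt
      · push Not at h0
        have hempty : ∀ t, {a : Fin n → ℕ | (Fin.cons 0 a : Fin (n + 1) → ℕ) ∈ A ∧
            ∑ i, a i = d + 1 + t}.ncard = 0 := by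
          intro t
          convert Set.ncard_empty (Fin n → ℕ)
          refine Set.eq_empty_iff_forall_notMem.2 fun a ha => ?_
          exact h0 _ ha.1 (by simp)
        simp only [hempty, add_zero]
        refine LexHilb.mul_first
          (ihd (by simp) {a : Fin (n + 1) → ℕ | a + Pi.single 0 1 ∈ A} ?_ ?_ ?_)
        · intro c hc
          obtain ⟨e, he, hec, hed⟩ := hgen _ hc
          obtain ⟨e, rfl⟩ := exists_eq_add_single_zero (h0 e he)
          refine ⟨e, he, le_of_add_le_add_right hec, ?_⟩
          rw [sum_add_single_zero] at hed
          omega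
        · intro c hc e hce
          exact hup _ hc _ (add_le_add_left hce _)
        · rintro c hc e hsum ⟨i, hi, hlt⟩
          refine hlex _ hc _ (by rw [sum_add_single_zero, sum_add_single_zero, hsum])
            ⟨i, fun j hj => ?_, ?_⟩
          · simp [hi j hj]
          · simpa using hlt

/-! ### Monomial ideals -/

section MonomialIdeal

variable {K : Type} [Field K] {n : ℕ} {I : Ideal (MvPolynomial (Fin n) K)}

lemma IsMonomialIdeal.mem_iff (hI : IsMonomialIdeal I) (p : MvPolynomial (Fin n) K) :
    p ∈ I ↔ ∀ a ∈ p.support, a ∈ expSet I := by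
  classical
  constructor
  · obtain ⟨G, -, rfl⟩ := hI
    intro hp a ha
    obtain ⟨g, hg, hga⟩ := mem_ideal_span_monomial_image.1 hp a ha
    rw [expSet, Set.mem_ofPred_eq, mem_ideal_span_monomial_image]
    intro b hb
    rw [support_monomial, if_neg one_ne_zero, Finset.mem_singleton] at hb
    exact ⟨g, hg, hb ▸ hga⟩
  · intro h
    rw [p.as_sum]
    refine I.sum_mem fun a ha => ?_
    have := I.mul_mem_left (C (coeff a p)) (h a ha)
    rwa [C_mul_monomial, mul_one] at this

lemma edeg_eq_degree (a : Fin n →₀ ℕ) : edeg a = a.degree := by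
  rw [edeg, Finsupp.degree_eq_sum]

lemma IsMonomialIdeal.hilb_eq_ncard (hI : IsMonomialIdeal I) (j : ℕ) :
    hilb I j = {a | a ∈ expSet I ∧ edeg a = j}.ncard := by
  have e : (Submodule.restrictScalars K I) ⊓ homogeneousSubmodule (Fin n) K j =
      restrictSupport K {a | a ∈ expSet I ∧ edeg a = j} := by
    ext p
    rw [Submodule.mem_inf, Submodule.restrictScalars_mem, hI.mem_iff, mem_homogeneousSubmodule,
      mem_restrictSupport_iff]
    constructor
    · rintro ⟨h1, h2⟩ a ha
      exact ⟨h1 a ha, by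
        rw [edeg_eq_degree, Finsupp.degree_eq_weight_one]
        exact h2 (mem_support_iff.1 ha)⟩
    · intro h
      refine ⟨fun a ha => (h ha).1, fun a ha => ?_⟩
      have := (h (mem_support_iff.2 ha)).2
      rwa [edeg_eq_degree, Finsupp.degree_eq_weight_one] at this
  rw [hilb, e, Module.finrank_eq_nat_card_basis (basisRestrictSupport K _), Nat.card_coe_set_eq]

/-- On an ideal without elements of degree less than `d`, taking components of degree `d` only sees
constant coefficients. -/
lemma homogeneousComponent_mul_of_order {d : ℕ} {g : MvPolynomial (Fin n) K}
    (hg : ∀ a ∈ g.support, d ≤ edeg a) (c : MvPolynomial (Fin n) K) :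
    homogeneousComponent d (c * g) = coeff 0 c • homogeneousComponent d g := by
  classical
  ext m
  rw [coeff_smul, coeff_homogeneousComponent, coeff_homogeneousComponent]
  split_ifs with hm
  · rw [coeff_mul, Finset.sum_eq_single (0, m), smul_eq_mul]
    · rintro ⟨x, y⟩ hxy hne
      rw [Finset.HasAntidiagonal.mem_antidiagonal] at hxy
      simp only at hxy ⊢
      by_contra hcon
      have hy := hg y (mem_support_iff.2 (right_ne_zero_of_mul hcon))
      rw [edeg_eq_degree] at hy
      rw [← hxy, map_add] at hm
      have hx : x = 0 := by
        rw [← Finsupp.degree_eq_zero_iff]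
        omega
      subst hx
      rw [zero_add] at hxy
      exact hne (by rw [hxy])
    · intro h
      simp at h
  · simp

lemma hilb_le_mu {d : ℕ} (hd : ∀ p ∈ I, ∀ a ∈ p.support, d ≤ edeg a) : hilb I d ≤ mu I := by
  classical
  have hne : {m | ∃ G : Finset (MvPolynomial (Fin n) K), G.card = m ∧
      I = Ideal.span (G : Set _)}.Nonempty := by
    obtain ⟨G, hG⟩ := (isNoetherianRing_iff_ideal_fg _).1 inferInstance I
    exact ⟨G.card, G, rfl, hG.symm⟩
  obtain ⟨G, hcard, hspan⟩ := Nat.sInf_mem hne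
  change G.card = mu I at hcard
  have hGI : ∀ g ∈ G, g ∈ I := fun g hg => by
    rw [hspan]
    exact Ideal.subset_span hg
  set V : Submodule K (MvPolynomial (Fin n) K) :=
    Submodule.span K ((G.image (homogeneousComponent d) : Finset _) : Set _) with hV
  have hcomp : ∀ p ∈ I, homogeneousComponent d p ∈ V := by
    intro p hp
    have hp' : p ∈ Submodule.span (MvPolynomial (Fin n) K) (G : Set (MvPolynomial (Fin n) K)) := by
      rw [hspan] at hp
      exact hp
    obtain ⟨c, -, rfl⟩ := Submodule.mem_span_finset.1 hp'
    rw [map_sum]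
    refine V.sum_mem fun g hg => ?_
    rw [smul_eq_mul, homogeneousComponent_mul_of_order (hd g (hGI g hg))]
    exact V.smul_mem _ (Submodule.subset_span (Finset.mem_image_of_mem _ hg))
  have hle : (Submodule.restrictScalars K I) ⊓ homogeneousSubmodule (Fin n) K d ≤ V := by
    rintro p ⟨hpI, hpd⟩
    have h1 := hcomp p hpI
    rwa [homogeneousComponent_of_mem hpd, if_pos rfl] at h1
  have : FiniteDimensional K V := FiniteDimensional.span_finset K _
  calc hilb I d ≤ Module.finrank K V := Submodule.finrank_mono hle
    _ ≤ (G.image (homogeneousComponent d)).card := finrank_span_finset_le_card _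
    _ ≤ G.card := Finset.card_image_le
    _ = mu I := hcard

end MonomialIdeal

/-- part of the proof of Theorem `hdepth_lex`. Let `I` be a lexsegment
ideal of `S = K[x_1,…,x_n]` generated by monomials of degree `d` with `μ(I) ≤ ξ_{n−1}`.
Then `hdepth_1(I) ≥ 2`. -/
theorem lexsegment_hdepth1_ge_two {K : Type} [Field K] {n d : ℕ}
    (I : Ideal (MvPolynomial (Fin n) K)) (hlex : IsLexsegment I)
    (hgen : GenBy I (fun a => edeg a = d)) (hmu : mu I ≤ xi (n - 1)) :
    2 ≤ hdepth1 I := by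
  refine le_sSup ⟨2, ShiftedPolySum.hilbertDecomp1 ?_, rfl⟩
  have hgen' : ∀ a ∈ expSet I, ∃ b ∈ expSet I, b ≤ a ∧ edeg b = d := by
    obtain ⟨G, hG, hI⟩ := hgen
    intro a ha
    rw [expSet, Set.mem_ofPred_eq, hI] at ha
    obtain ⟨b, hb, hba⟩ := mem_ideal_span_monomial_image.1 ha a (by simp)
    refine ⟨b, ?_, hba, hG b hb⟩
    rw [expSet, Set.mem_ofPred_eq, hI]
    exact Ideal.subset_span ⟨b, hb, rfl⟩
  have hord : ∀ a ∈ expSet I, d ≤ edeg a := by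
    intro a ha
    obtain ⟨b, -, hba, rfl⟩ := hgen' a ha
    exact Finset.sum_le_sum fun i _ => hba i
  have hle : hilb I d ≤ xi (n - 1) :=
    (hilb_le_mu fun p hp a ha => hord a ((hlex.1.mem_iff p).1 hp a ha)).trans hmu
  let φ : (Fin n →₀ ℕ) ≃ (Fin n → ℕ) := Finsupp.equivFunOnFinite
  have hφ : ∀ t, hilb I (d + t) = {a | a ∈ φ '' expSet I ∧ ∑ i, a i = d + t}.ncard := by
    intro t
    rw [hlex.1.hilb_eq_ncard, ← Set.ncard_image_of_injective _ φ.injective]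
    congr 1
    ext a
    constructor
    · rintro ⟨b, ⟨hb, hbd⟩, rfl⟩
      exact ⟨⟨b, hb, rfl⟩, hbd⟩
    · rintro ⟨⟨b, hb, rfl⟩, hbd⟩
      exact ⟨b, ⟨hb, hbd⟩, rfl⟩
  have hH : LexHilb n d fun t => hilb I (d + t) := by
    by_cases hnd : n = 0 → d ≠ 0
    · simp only [hφ]
      refine lexHilb_ncard hnd _ ?_ ?_ ?_
      · rintro _ ⟨a, ha, rfl⟩
        obtain ⟨b, hb, hba, hbd⟩ := hgen' a ha
        exact ⟨φ b, ⟨b, hb, rfl⟩, hba, hbd⟩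
      · rintro _ ⟨a, ha, rfl⟩ b hab
        obtain ⟨b, rfl⟩ := φ.surjective b
        refine ⟨b, ?_, rfl⟩
        have hab' : a ≤ b := hab
        have := I.mul_mem_left (monomial (b - a) 1) ha
        rwa [monomial_mul, one_mul, tsub_add_cancel_of_le hab'] at this
      · rintro _ ⟨a, ha, rfl⟩ b hsum hb
        obtain ⟨b, rfl⟩ := φ.surjective b
        exact ⟨b, hlex.2 a b ha hsum hb, rfl⟩
    · push Not at hnd
      obtain ⟨rfl, rfl⟩ := hnd
      have hzero : hilb I 0 = 0 := by simpa [xi] using hle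
      convert LexHilb.zero 0 0 using 2 with t
      rcases t with _ | t
      · exact hzero
      · rw [hφ]
        simp
  refine hH.polySum.shiftedPolySum (hH.two_mul_le hle) (s := d) (fun j hj => ?_) fun t => ?_
  · unfold hilbZ
    split_ifs with hj0
    · rw [hlex.1.hilb_eq_ncard]
      convert Set.ncard_empty (Fin n →₀ ℕ)
      refine Set.eq_empty_iff_forall_notMem.2 fun a ha => ?_
      have h1 := hord a ha.1
      have h2 : edeg a = j.toNat := ha.2
      omega
    · rfl
  · have h0 : (0 : ℤ) ≤ d + t := by omega
    rw [hilbZ, if_pos h0]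
    congr 1
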